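/- arXiv:1909.10386 — 2 statements merged into one kernel-verified Lean document; each statement's English description precedes it below -/
import Mathlib

section
/- For every integer m ≥ 2, d(m, 2m + 9) ≤ 1073; that is, there exists an integral point set of 2m + 9 points in m-dimensional Euclidean space ℝ^m whose diameter is at most 1073. -/
/-- Positions on an axis of eleven collinear points with integral distances to both points at
height `√20160` above the positions `0` and `195`. -/
def axisPosition : Fin 11 → ℤ :=
  ![-299, -104, -67, -24, 57, 86, 109, 138, 219, 262, 299]

/-- Distance from the collinear point `i` to the point above `0` (`false`) or `195` (`true`). -/
def axisDistance (i : Fin 11) (b : Bool) : ℕ :=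
  if b then ![514, 331, 298, 261, 198, 179, 166, 153, 144, 157, 176] i
  else ![331, 176, 157, 144, 153, 166, 179, 198, 261, 298, 331] i

/-- Eleven collinear points together with two parallel simplices on `n + 1` vertices each. -/
abbrev PointIndex (n : ℕ) : Type := Fin 11 ⊕ (Fin (n + 1) × Bool)

/-- The coordinate of a point along the axis. -/
def height {n : ℕ} : PointIndex n → ℤ
  | .inl i => axisPosition i
  | .inr (_, b) => if b then 195 else 0

/-- The squared distance between the projections of two points to the orthogonal complement of
the axis. -/
def radialSqDist {n : ℕ} : PointIndex n → PointIndex n → ℤ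
  | .inl _, .inl _ => 0
  | .inl _, .inr _ => 20160
  | .inr _, .inl _ => 20160
  | .inr (i, _), .inr (j, _) => if i = j then 0 else 784

lemma axisPosition_sq_add (i : Fin 11) (b : Bool) :
    (axisPosition i - (if b then 195 else 0)) ^ 2 + 20160 = (axisDistance i b : ℤ) ^ 2 ∧
      0 < axisDistance i b ∧ axisDistance i b ≤ 1073 := by
  revert i b
  decide

lemma axisPosition_injective : Function.Injective axisPosition := by
  decide

lemma natAbs_axisPosition_sub_le (i j : Fin 11) :
    (axisPosition i - axisPosition j).natAbs ≤ 1073 := by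
  revert i j
  decide

/-- All squared distances in the configuration are squares of integers at most `1073`. -/
lemma exists_sq_eq_height_sub_sq_add {n : ℕ} (p q : PointIndex n) :
    ∃ z : ℕ, (height p - height q) ^ 2 + radialSqDist p q = (z : ℤ) ^ 2 ∧ z ≤ 1073 ∧
      (z = 0 → p = q) := by
  rcases p with i | ⟨i, b⟩ <;> rcases q with j | ⟨j, c⟩
  · refine ⟨(axisPosition i - axisPosition j).natAbs, by simp [height, radialSqDist],
      natAbs_axisPosition_sub_le i j, fun h => ?_⟩
    rw [Int.natAbs_eq_zero, sub_eq_zero] at h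
    rw [axisPosition_injective h]
  · obtain ⟨h, hpos, hle⟩ := axisPosition_sq_add i c
    exact ⟨axisDistance i c, h, hle, fun h0 => by omega⟩
  · obtain ⟨h, hpos, hle⟩ := axisPosition_sq_add j b
    refine ⟨axisDistance j b, ?_, hle, fun h0 => by omega⟩
    rw [← h]
    simp only [height, radialSqDist]
    ring
  · by_cases hij : i = j
    · subst hij
      by_cases hbc : b = c
      · subst hbc
        exact ⟨0, by simp [radialSqDist], by norm_num, fun _ => rfl⟩
      · refine ⟨195, ?_, by norm_num, by norm_num⟩
        cases b <;> cases c <;> simp_all [height, radialSqDist]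
    · by_cases hbc : b = c
      · subst hbc
        exact ⟨28, by simp [height, radialSqDist, hij], by norm_num, by norm_num⟩
      · refine ⟨197, ?_, by norm_num, by norm_num⟩
        cases b <;> cases c <;> simp_all [height, radialSqDist]

/-- The point with the given index; the simplices have vertices `s • eᵢ + t • ∑ⱼ eⱼ`. -/
noncomputable def configPoint {n : ℕ} (s t : ℝ) (p : PointIndex n) :
    EuclideanSpace ℝ (Fin (n + 2)) :=
  WithLp.toLp 2 (Fin.cons (height p : ℝ)
    (match p with
      | .inl _ => fun _ => 0
      | .inr (i, _) => fun j => (if j = i then s else 0) + t))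

section

variable {n : ℕ} {s t : ℝ}

lemma sum_ite_add_sq (i : Fin (n + 1)) :
    ∑ j, ((if j = i then s else 0) + t) ^ 2 = s ^ 2 + 2 * s * t + (n + 1) * t ^ 2 := by
  have h (j : Fin (n + 1)) : ((if j = i then s else 0) + t) ^ 2 =
      (if j = i then s ^ 2 + 2 * s * t else 0) + t ^ 2 := by
    split_ifs <;> ring
  simp [h, Finset.sum_add_distrib]

lemma sum_ite_sub_ite_sq {i k : Fin (n + 1)} (hik : i ≠ k) :
    ∑ j, ((if j = i then s else 0) - (if j = k then s else 0)) ^ 2 = 2 * s ^ 2 := by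
  have h (j : Fin (n + 1)) : ((if j = i then s else 0) - (if j = k then s else 0)) ^ 2 =
      (if j = i then s ^ 2 else 0) + (if j = k then s ^ 2 else 0) := by
    split_ifs <;> simp_all
  simp only [h, Finset.sum_add_distrib, Finset.sum_ite_eq', Finset.mem_univ, if_true]
  ring

lemma dist_configPoint_sq (hs : s ^ 2 = 392) (ht : 2 * s * t + (n + 1) * t ^ 2 = 19768)
    (p q : PointIndex n) :
    dist (configPoint s t p) (configPoint s t q) ^ 2 =
      (((height p - height q) ^ 2 + radialSqDist p q : ℤ) : ℝ) := by
  have hradius (i : Fin (n + 1)) : ∑ j, ((if j = i then s else 0) + t) ^ 2 = 20160 := by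
    rw [sum_ite_add_sq]
    linarith
  rw [EuclideanSpace.dist_eq, Real.sq_sqrt (Finset.sum_nonneg fun _ _ => sq_nonneg _),
    Fin.sum_univ_succ]
  simp only [Real.dist_eq, sq_abs]
  push_cast
  rcases p with i | ⟨i, b⟩ <;> rcases q with j | ⟨j, c⟩
  · simp [configPoint, radialSqDist]
  · simp [configPoint, radialSqDist, -neg_add_rev, hradius]
  · simp [configPoint, radialSqDist, hradius]
  · by_cases hij : i = j
    · simp [configPoint, radialSqDist, hij]
    · simp only [configPoint, radialSqDist, hij, Fin.cons_zero, Fin.cons_succ,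
        add_sub_add_right_eq_sub, if_false, sum_ite_sub_ite_sq hij, hs]
      norm_num

lemma affineSpan_range_configPoint (hs : 0 < s) (ht : 0 ≤ t) :
    affineSpan ℝ (Set.range (configPoint (n := n) s t)) = ⊤ := by
  set A := affineSpan ℝ (Set.range (configPoint (n := n) s t))
  have hmem (p : PointIndex n) : configPoint s t p ∈ A :=
    subset_affineSpan ℝ _ (Set.mem_range_self p)
  have hsub (p q : PointIndex n) : configPoint s t p - configPoint s t q ∈ A.direction :=
    A.vsub_mem_direction (hmem p) (hmem q)
  have haxis : EuclideanSpace.single 0 (1 : ℝ) ∈ A.direction := by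
    convert A.direction.smul_mem (195⁻¹ : ℝ) (hsub (.inr (0, true)) (.inr (0, false))) using 1
    ext k
    refine Fin.cases ?_ (fun j => ?_) k <;> simp [configPoint, height]
  have hvertex (i : Fin (n + 1)) :
      WithLp.toLp 2 (Fin.cons 0 fun j => (if j = i then s else 0) + t) ∈ A.direction := by
    convert A.direction.add_mem (hsub (.inr (i, false)) (.inl 4))
      (A.direction.smul_mem (57 : ℝ) haxis) using 1
    ext k
    refine Fin.cases ?_ (fun j => ?_) k <;> simp [configPoint, height, axisPosition]
  have hpos : 0 < s + (n + 1) * t := by positivity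
  have hones : WithLp.toLp 2 (Fin.cons 0 fun _ : Fin (n + 1) => (1 : ℝ)) ∈ A.direction := by
    convert A.direction.smul_mem (s + (n + 1) * t)⁻¹
      (A.direction.sum_mem fun i (_ : i ∈ Finset.univ) => hvertex i) using 1
    ext k
    refine Fin.cases ?_ (fun j => ?_) k
    · simp
    · simp [Finset.sum_add_distrib, hpos.ne']
  have hsingle (i : Fin (n + 1)) : EuclideanSpace.single i.succ (1 : ℝ) ∈ A.direction := by
    convert A.direction.smul_mem s⁻¹
      (A.direction.sub_mem (hvertex i) (A.direction.smul_mem t hones)) using 1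
    ext k
    refine Fin.cases ?_ (fun j => ?_) k
    · simp
    · by_cases hji : j = i <;> simp [hji, hs.ne']
  rw [← AffineSubspace.direction_eq_top_iff_of_nonempty ⟨_, hmem (.inl 0)⟩, eq_top_iff,
    ← (EuclideanSpace.basisFun (Fin (n + 2)) ℝ).toBasis.span_eq, Submodule.span_le]
  rintro _ ⟨k, rfl⟩
  refine Fin.cases ?_ (fun j => ?_) k
  · simpa using haxis
  · simpa using hsingle j

end

lemma exists_simplex_parameters (n : ℕ) :
    ∃ s t : ℝ, 0 < s ∧ 0 ≤ t ∧ s ^ 2 = 392 ∧ 2 * s * t + (n + 1) * t ^ 2 = 19768 := by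
  have hr : √(392 + (n + 1) * 19768 : ℝ) ^ 2 = 392 + (n + 1) * 19768 :=
    Real.sq_sqrt (by positivity)
  have hs : √(392 : ℝ) ^ 2 = 392 := Real.sq_sqrt (by norm_num)
  refine ⟨√392, (√(392 + (n + 1) * 19768) - √392) / (n + 1), by positivity, ?_, hs, ?_⟩
  · refine div_nonneg (sub_nonneg.2 (Real.sqrt_le_sqrt ?_)) (by positivity)
    have : (0 : ℝ) ≤ n := n.cast_nonneg
    linarith
  · field_simp
    linear_combination hr - hs

/-- For every integer `m ≥ 2`, there exists an integral point set of `2 * m + 9` points in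
`ℝ^m` (pairwise integral distances, not contained in any affine hyperplane) whose
diameter is at most `1073`; that is, `d(m, 2 * m + 9) ≤ 1073`. -/
theorem d_bound_stmt_11 :
    ∀ m : ℕ, 2 ≤ m →
      ∃ S : Finset (EuclideanSpace ℝ (Fin m)),
        S.card = 2 * m + 9 ∧
        affineSpan ℝ (S : Set (EuclideanSpace ℝ (Fin m))) = ⊤ ∧
        (∀ p ∈ S, ∀ q ∈ S, ∃ z : ℤ, dist p q = (z : ℝ)) ∧
        Metric.diam (S : Set (EuclideanSpace ℝ (Fin m))) ≤ 1073 := by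
  intro m hm
  obtain ⟨n, rfl⟩ := Nat.exists_eq_add_of_le' hm
  obtain ⟨s, t, hs0, ht0, hs, ht⟩ := exists_simplex_parameters n
  have hdist (p q : PointIndex n) : ∃ z : ℕ,
      dist (configPoint s t p) (configPoint s t q) = z ∧ z ≤ 1073 ∧ (z = 0 → p = q) := by
    obtain ⟨z, hz, hle, h0⟩ := exists_sq_eq_height_sub_sq_add p q
    refine ⟨z, ?_, hle, h0⟩
    rw [← sq_eq_sq₀ dist_nonneg z.cast_nonneg, dist_configPoint_sq hs ht, hz]
    push_cast
    rfl
  have hinj : Function.Injective (configPoint (n := n) s t) := by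
    intro p q hpq
    obtain ⟨z, hz, -, h0⟩ := hdist p q
    rw [hpq, dist_self] at hz
    exact h0 (by exact_mod_cast hz.symm)
  refine ⟨Finset.univ.map ⟨configPoint s t, hinj⟩, ?_, ?_, ?_, ?_⟩
  · simp
    ring
  · simpa using affineSpan_range_configPoint hs0 ht0
  · simp only [Finset.mem_map, Finset.mem_univ, true_and, Function.Embedding.coeFn_mk]
    rintro _ ⟨p, rfl⟩ _ ⟨q, rfl⟩
    obtain ⟨z, hz, -⟩ := hdist p q
    exact ⟨z, by rw [hz, Int.cast_natCast]⟩
  · refine Metric.diam_le_of_forall_dist_le (by norm_num) ?_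
    simp only [Finset.coe_map, Finset.coe_univ, Set.image_univ, Function.Embedding.coeFn_mk]
    rintro _ ⟨p, rfl⟩ _ ⟨q, rfl⟩
    obtain ⟨z, hz, hle, -⟩ := hdist p q
    rw [hz]
    exact_mod_cast hle
end

section
/- For every integer m ≥ 2, d(m, 2m + 10) ≤ 1273; that is, there exists an integral point set of 2m + 10 points in m-dimensional Euclidean space ℝ^m whose diameter is at most 1273. -/
namespace IntegralPointSet

/-- Twelve integers `t` such that `t ^ 2 + 20160` and `(t - 195) ^ 2 + 20160` are squares. -/
def apexHeight : Fin 12 → ℤ :=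
  ![-299, -104, -67, -24, 57, 86, 109, 138, 219, 262, 299, 494]

/-- The two heights over each vertex of the regular simplex. -/
def sideHeight : Bool → ℤ
  | false => 0
  | true => 195

/-- The distance from an apex point to a side point. -/
def apexSideDist : Fin 12 → Bool → ℤ
  | k, false => ![331, 176, 157, 144, 153, 166, 179, 198, 261, 298, 331, 514] k
  | k, true => ![514, 331, 298, 261, 198, 179, 166, 153, 144, 157, 176, 331] k

lemma apexSideDist_spec (k : Fin 12) (e : Bool) :
    0 < apexSideDist k e ∧ apexSideDist k e ≤ 1273 ∧
      (apexHeight k - sideHeight e) ^ 2 + 20160 = apexSideDist k e ^ 2 := by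
  revert k e; decide

lemma abs_apexHeight_sub (k l : Fin 12) (h : k ≠ l) :
    0 < |apexHeight k - apexHeight l| ∧ |apexHeight k - apexHeight l| ≤ 1273 := by
  revert k l; decide

lemma exists_sideDist_self (e e' : Bool) (h : e ≠ e') :
    ∃ z : ℤ, 0 < z ∧ z ≤ 1273 ∧ (sideHeight e - sideHeight e') ^ 2 = z ^ 2 :=
  ⟨195, by revert e e'; decide⟩

lemma exists_sideDist_ne (e e' : Bool) :
    ∃ z : ℤ, 0 < z ∧ z ≤ 1273 ∧ (sideHeight e - sideHeight e') ^ 2 + 784 = z ^ 2 :=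
  ⟨if e = e' then 28 else 197, by revert e e'; decide⟩

/-- The common coordinate of the apex points in the hyperplane of the simplex. -/
noncomputable def apexCoord (n : ℕ) : ℝ := (14 * √2 + √(392 + n * 19768)) / n

lemma mul_apexCoord {n : ℕ} (hn : n ≠ 0) :
    n * apexCoord n = 14 * √2 + √(392 + n * 19768) := by
  have : (n : ℝ) ≠ 0 := by exact_mod_cast hn
  unfold apexCoord
  field_simp

lemma apexCoord_sq {n : ℕ} (hn : n ≠ 0) :
    n * apexCoord n ^ 2 - 28 * √2 * apexCoord n + 392 = 20160 := by
  have hn' : (n : ℝ) ≠ 0 := by exact_mod_cast hn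
  have h := mul_apexCoord hn
  have h2 : √(2 : ℝ) ^ 2 = 2 := Real.sq_sqrt (by norm_num)
  have hd : √(392 + n * 19768 : ℝ) ^ 2 = 392 + n * 19768 := Real.sq_sqrt (by positivity)
  have h3 : (n * apexCoord n - 14 * √2) ^ 2 = 392 + n * 19768 := by
    rw [h, add_sub_cancel_left, hd]
  apply mul_left_cancel₀ hn'
  linear_combination h3 - 196 * h2

/-- The points: twelve apex points on a line, and two points over each vertex of a regular
simplex with `n` vertices and side length `28`. -/
noncomputable def point (n : ℕ) :
    Fin 12 ⊕ (Fin n × Bool) → EuclideanSpace ℝ (Fin (n + 1))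
  | .inl k => WithLp.toLp 2 (Fin.cons (apexHeight k : ℝ) fun _ => apexCoord n)
  | .inr (i, e) => WithLp.toLp 2 (Fin.cons (sideHeight e : ℝ) (Pi.single i (14 * √2)))

lemma dist_sq_cons {n : ℕ} (a b : ℝ) (v w : Fin n → ℝ) :
    dist (WithLp.toLp 2 (Fin.cons a v) : EuclideanSpace ℝ (Fin (n + 1)))
      (WithLp.toLp 2 (Fin.cons b w)) ^ 2 = (a - b) ^ 2 + ∑ i, (v i - w i) ^ 2 := by
  rw [EuclideanSpace.dist_eq, Real.sq_sqrt (by positivity)]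
  simp [Fin.sum_univ_succ, Real.dist_eq, sq_abs]

lemma sum_const_sub_single_sq {n : ℕ} (i : Fin n) (s c : ℝ) :
    ∑ j, (s - Pi.single (M := fun _ => ℝ) i c j) ^ 2 = n * s ^ 2 - 2 * c * s + c ^ 2 := by
  have h (j : Fin n) : (s - Pi.single (M := fun _ => ℝ) i c j) ^ 2 =
      s ^ 2 + if j = i then c ^ 2 - 2 * c * s else 0 := by
    by_cases hj : j = i
    · subst hj; simp; ring
    · simp [hj]
  simp_rw [h, Finset.sum_add_distrib]
  simp
  ring

lemma sum_single_sub_single_sq {n : ℕ} {i i' : Fin n} (hi : i ≠ i') (c : ℝ) :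
    ∑ j, (Pi.single (M := fun _ => ℝ) i c j - Pi.single (M := fun _ => ℝ) i' c j) ^ 2 =
      2 * c ^ 2 := by
  have h (j : Fin n) :
      (Pi.single (M := fun _ => ℝ) i c j - Pi.single (M := fun _ => ℝ) i' c j) ^ 2 =
      (if j = i then c ^ 2 else 0) + if j = i' then c ^ 2 else 0 := by
    by_cases hj : j = i
    · subst hj; simp [hi]
    · by_cases hj' : j = i'
      · subst hj'; simp [hj]
      · simp [hj, hj']
  simp_rw [h, Finset.sum_add_distrib]
  simp
  ring

lemma exists_dist_eq_of_sq {α : Type*} [PseudoMetricSpace α] {p q : α} {z : ℤ} (hz : 0 < z)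
    (hz' : z ≤ 1273) (h : dist p q ^ 2 = (z : ℝ) ^ 2) :
    ∃ z : ℤ, 0 < z ∧ z ≤ 1273 ∧ dist p q = z :=
  ⟨z, hz, hz', (sq_eq_sq₀ dist_nonneg (by exact_mod_cast hz.le)).1 h⟩

lemma exists_dist_apex_side {n : ℕ} (hn : n ≠ 0) (k : Fin 12) (i : Fin n) (e : Bool) :
    ∃ z : ℤ, 0 < z ∧ z ≤ 1273 ∧ dist (point n (.inl k)) (point n (.inr (i, e))) = z := by
  obtain ⟨h1, h2, h3⟩ := apexSideDist_spec k e
  refine exists_dist_eq_of_sq h1 h2 ?_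
  have h3' : ((apexHeight k : ℝ) - sideHeight e) ^ 2 + 20160 = (apexSideDist k e : ℝ) ^ 2 := by
    exact_mod_cast h3
  have hs : √(2 : ℝ) ^ 2 = 2 := Real.sq_sqrt (by norm_num)
  rw [point, point, dist_sq_cons, sum_const_sub_single_sq]
  linear_combination h3' + apexCoord_sq hn + 196 * hs

lemma exists_dist_point {n : ℕ} (hn : n ≠ 0) (x y : Fin 12 ⊕ (Fin n × Bool)) (hxy : x ≠ y) :
    ∃ z : ℤ, 0 < z ∧ z ≤ 1273 ∧ dist (point n x) (point n y) = z := by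
  rcases x with k | ⟨i, e⟩ <;> rcases y with l | ⟨j, e'⟩
  · obtain ⟨h1, h2⟩ := abs_apexHeight_sub k l (by simpa using hxy)
    refine exists_dist_eq_of_sq h1 h2 ?_
    rw [point, point, dist_sq_cons]
    simp
  · exact exists_dist_apex_side hn k j e'
  · rw [dist_comm]
    exact exists_dist_apex_side hn l i e
  · by_cases hij : i = j
    · subst hij
      obtain ⟨z, h1, h2, h3⟩ := exists_sideDist_self e e' (by simpa using hxy)
      refine exists_dist_eq_of_sq h1 h2 ?_
      rw [point, point, dist_sq_cons]
      simpa using mod_cast h3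
    · obtain ⟨z, h1, h2, h3⟩ := exists_sideDist_ne e e'
      refine exists_dist_eq_of_sq h1 h2 ?_
      have h3' : ((sideHeight e : ℝ) - sideHeight e') ^ 2 + 784 = (z : ℝ) ^ 2 := by
        exact_mod_cast h3
      have hs : √(2 : ℝ) ^ 2 = 2 := Real.sq_sqrt (by norm_num)
      rw [point, point, dist_sq_cons, sum_single_sub_single_sq hij]
      linear_combination h3' + 392 * hs

lemma point_injective {n : ℕ} (hn : n ≠ 0) : Function.Injective (point n) := by
  intro x y h
  by_contra hxy
  obtain ⟨z, hz, -, hd⟩ := exists_dist_point hn x y hxy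
  rw [h, dist_self] at hd
  exact hz.ne (by exact_mod_cast hd)

lemma affineSpan_range_point {n : ℕ} (hn : n ≠ 0) :
    affineSpan ℝ (Set.range (point n)) = ⊤ := by
  rw [AffineSubspace.affineSpan_eq_top_iff_vectorSpan_eq_top_of_nonempty _ _ _
    (Set.range_nonempty _), ← Submodule.orthogonal_eq_bot_iff, Submodule.eq_bot_iff]
  intro v hv
  have key (x y) : inner ℝ (point n x - point n y) v = 0 :=
    (Submodule.mem_orthogonal _ _).1 hv _
      (vsub_mem_vectorSpan ℝ (Set.mem_range_self x) (Set.mem_range_self y))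
  have hzero : v 0 = 0 := by
    have h := key (.inr (⟨0, Nat.pos_of_ne_zero hn⟩, true))
      (.inr (⟨0, Nat.pos_of_ne_zero hn⟩, false))
    simpa [point, PiLp.inner_apply, Fin.sum_univ_succ, sideHeight] using h
  have hsucc (i : Fin n) : v i.succ * (14 * √2) = apexCoord n * ∑ j : Fin n, v j.succ := by
    have h := key (.inl 0) (.inr (i, false))
    simp [point, PiLp.inner_apply, Fin.sum_univ_succ, hzero, mul_sub, Finset.sum_sub_distrib,
      Pi.single_apply, ← Finset.sum_mul] at h
    linear_combination -h
  have hsum : ∑ j : Fin n, v j.succ = 0 := by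
    have h : (∑ j : Fin n, v j.succ) * (14 * √2) =
        n * (apexCoord n * ∑ j : Fin n, v j.succ) := by
      rw [Finset.sum_mul, Finset.sum_congr rfl fun i _ => hsucc i]
      simp
    have hpos : 0 < √(392 + n * 19768 : ℝ) := by positivity
    refine (mul_eq_zero.1 (?_ : √(392 + n * 19768 : ℝ) * _ = 0)).resolve_left hpos.ne'
    linear_combination -h - (∑ j : Fin n, v j.succ) * mul_apexCoord hn
  ext i
  refine Fin.cases hzero (fun i => ?_) i
  have h := hsucc i
  rw [hsum, mul_zero] at h
  exact (mul_eq_zero.1 h).resolve_right (by positivity)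

end IntegralPointSet

open IntegralPointSet in
/-- For every integer `m ≥ 2`, there exists an integral point set of `2 * m + 10` points in
`ℝ^m` (pairwise integral distances, not contained in any affine hyperplane) whose
diameter is at most `1273`; that is, `d(m, 2 * m + 10) ≤ 1273`. -/
theorem d_bound_stmt_12 :
    ∀ m : ℕ, 2 ≤ m →
      ∃ S : Finset (EuclideanSpace ℝ (Fin m)),
        S.card = 2 * m + 10 ∧
        affineSpan ℝ (S : Set (EuclideanSpace ℝ (Fin m))) = ⊤ ∧
        (∀ p ∈ S, ∀ q ∈ S, ∃ z : ℤ, dist p q = (z : ℝ)) ∧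
        Metric.diam (S : Set (EuclideanSpace ℝ (Fin m))) ≤ 1273 := by
  intro m hm
  obtain ⟨n, rfl⟩ : ∃ n, m = n + 1 := ⟨m - 1, by omega⟩
  have hn : n ≠ 0 := by omega
  refine ⟨Finset.univ.map ⟨point n, point_injective hn⟩, ?_, ?_, ?_, ?_⟩
  · simp
    ring
  · simpa using affineSpan_range_point hn
  · simp only [Finset.mem_map, Finset.mem_univ, true_and, Function.Embedding.coeFn_mk]
    rintro _ ⟨x, rfl⟩ _ ⟨y, rfl⟩
    by_cases hxy : x = y
    · exact ⟨0, by simp [hxy]⟩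
    · obtain ⟨z, -, -, hz⟩ := exists_dist_point hn x y hxy
      exact ⟨z, hz⟩
  · refine Metric.diam_le_of_forall_dist_le (by norm_num) ?_
    simp only [Finset.coe_map, Finset.coe_univ, Set.image_univ, Function.Embedding.coeFn_mk]
    rintro _ ⟨x, rfl⟩ _ ⟨y, rfl⟩
    by_cases hxy : x = y
    · simp [hxy]
    · obtain ⟨z, -, hz', hz⟩ := exists_dist_point hn x y hxy
      rw [hz]
      exact_mod_cast hz'
end
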